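/- arXiv:0903.4355 — 6 statements merged into one kernel-verified Lean document; each statement's English description precedes it below -/
import Mathlib

section
/- For every positive integer c there exists N such that for all n ≥ N, every metric space on n points admits an isometric embedding into l_∞^{n-c}, i.e. into ℝ^{n-c} equipped with the supremum distance. Equivalently, writing m(n) for the maximum over all n-point metric spaces X of the least k such that X embeds isometrically into l_∞^k, the quantity α(n) = n − m(n) tends to infinity as n → ∞. -/
/-- `l_∞^k`: `ℝ^k` with the supremum distance. -/
abbrev LinfSpace (k : ℕ) := PiLp ⊤ (fun _ : Fin k => ℝ)

open Finset in
theorem ramsey_aux (C : Type) [Fintype C] (r : ℕ) : ∀ s : ℕ, ∃ N : ℕ, ∀ A : Finset ℕ, N ≤ A.card →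
    ∀ col : Finset ℕ → C, ∃ B ⊆ A, B.card = s ∧ ∃ c : C, ∀ T ⊆ B, T.card = r → col T = c := by
  classical
  induction r with
  | zero =>
    intro s
    refine ⟨s, fun A hA col => ?_⟩
    obtain ⟨B, hB, hBs⟩ := Finset.exists_subset_card_eq hA
    refine ⟨B, hB, hBs, col ∅, fun T _ hT => ?_⟩
    rw [Finset.card_eq_zero.1 hT]
  | succ r ih =>
    have key : ∀ t : ℕ, ∃ N : ℕ, ∀ A : Finset ℕ, N ≤ A.card → ∀ col : Finset ℕ → C,
        ∃ B ⊆ A, B.card = t ∧ ∃ g : ℕ → C, ∀ T ⊆ B, T.card = r + 1 →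
          ∀ a ∈ T, (∀ b ∈ T, a ≤ b) → col T = g a := by
      intro t
      induction t with
      | zero =>
        refine ⟨0, fun A _ col => ⟨∅, by simp, rfl, fun _ => col ∅, fun T hT hc => ?_⟩⟩
        rw [Finset.subset_empty.1 hT] at hc
        simp at hc
      | succ t iht =>
        obtain ⟨N1, hN1⟩ := iht
        obtain ⟨N2, hN2⟩ := ih N1
        refine ⟨N2 + 1, fun A hA col => ?_⟩
        have hne : A.Nonempty := Finset.card_pos.1 (by omega)
        set a := A.min' hne with ha
        have haA : a ∈ A := A.min'_mem hne
        obtain ⟨A2, hA2, hA2c, c, hc⟩ := hN2 (A.erase a)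
          (by rw [Finset.card_erase_of_mem haA]; omega) (fun T => col (insert a T))
        obtain ⟨B, hB, hBc, g, hg⟩ := hN1 A2 hA2c.ge col
        have haB : a ∉ B := fun h => by
          have := hA2 (hB h)
          simp at this
        refine ⟨insert a B, ?_, by rw [Finset.card_insert_of_notMem haB, hBc],
          Function.update g a c, ?_⟩
        · intro x hx
          rcases Finset.mem_insert.1 hx with rfl | hx
          · exact haA
          · exact Finset.mem_of_mem_erase (hA2 (hB hx))
        · intro T hT hTc b hb hmin
          by_cases hab : a ∈ T
          · have h1 : b ≤ a := hmin a hab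
            have h2 : a ≤ b := by
              rcases Finset.mem_insert.1 (hT hb) with h | h
              · exact h.ge
              · exact A.min'_le b (Finset.mem_of_mem_erase (hA2 (hB h)))
            have h3 : b = a := le_antisymm h1 h2
            rw [h3, Function.update_self]
            have := hc (T.erase a) (fun x hx => by
              have hxT := Finset.mem_of_mem_erase hx
              rcases Finset.mem_insert.1 (hT hxT) with h | h
              · exact absurd h (Finset.ne_of_mem_erase hx)
              · exact hB h) (by rw [Finset.card_erase_of_mem hab]; omega)
            simpa [Finset.insert_erase hab] using this
          · have hne : b ≠ a := fun h => hab (h ▸ hb)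
            rw [Function.update_of_ne hne]
            refine hg T (fun x hx => ?_) hTc b hb hmin
            rcases Finset.mem_insert.1 (hT hx) with h | h
            · exact absurd (h ▸ hx) hab
            · exact h
    intro s
    obtain ⟨N, hN⟩ := key (Fintype.card C * s)
    refine ⟨N + 1, fun A hA col => ?_⟩
    obtain ⟨B, hB, hBc, g, hg⟩ := hN A (by omega) col
    have : Nonempty C := ⟨col ∅⟩
    obtain ⟨c, -, hc⟩ := Finset.exists_le_card_fiber_of_mul_le_card_of_maps_to
      (s := B) (t := (Finset.univ : Finset C)) (f := g) (n := s) (fun _ _ => Finset.mem_univ _)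
      Finset.univ_nonempty (by rw [hBc, Finset.card_univ])
    obtain ⟨B', hB', hB'c⟩ := Finset.exists_subset_card_eq hc
    have hsub : B' ⊆ B := fun x hx => (Finset.mem_filter.1 (hB' hx)).1
    refine ⟨B', hsub.trans hB, hB'c, c, fun T hT hTc => ?_⟩
    have hTne : T.Nonempty := Finset.card_pos.1 (by omega)
    rw [hg T (hT.trans hsub) hTc (T.min' hTne) (T.min'_mem hTne) (fun b hb => T.min'_le b hb)]
    exact (Finset.mem_filter.1 (hB' (hT (T.min'_mem hTne)))).2

/-- `k` functions suffice for the points `q 0, …, q (s-1)`. -/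
def LCov {X : Type} [MetricSpace X] (q : ℕ → X) (s k : ℕ) : Prop :=
  ∃ G : Finset (X → ℝ), G.card ≤ k ∧ (∀ f ∈ G, LipschitzWith 1 f) ∧
    ∀ i j, i < j → j < s → ∃ f ∈ G, |f (q i) - f (q j)| = dist (q i) (q j)

/-- the double star -/
noncomputable def dstar {X : Type} [MetricSpace X] (a b z : X) : X → ℝ :=
  fun v => min (dist a v) (dist b v + (dist a z - dist b z))

theorem dstar_lip {X : Type} [MetricSpace X] (a b z : X) : LipschitzWith 1 (dstar a b z) := by
  apply LipschitzWith.of_dist_le_mul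
  intro x y
  rw [Real.dist_eq]
  simp only [NNReal.coe_one, one_mul, dstar]
  have h1 := dist_triangle a x y
  have h2 := dist_triangle a y x
  have h3 := dist_triangle b x y
  have h4 := dist_triangle b y x
  rw [dist_comm y x] at h2 h4
  rw [abs_le]
  constructor
  · rcases min_choice (dist a x) (dist b x + (dist a z - dist b z)) with h | h <;> rw [h]
    · linarith [min_le_left (dist a y) (dist b y + (dist a z - dist b z))]
    · linarith [min_le_right (dist a y) (dist b y + (dist a z - dist b z))]
  · rcases min_choice (dist a y) (dist b y + (dist a z - dist b z)) with h | h <;> rw [h]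
    · linarith [min_le_left (dist a x) (dist b x + (dist a z - dist b z))]
    · linarith [min_le_right (dist a x) (dist b x + (dist a z - dist b z))]

theorem dstar_left {X : Type} [MetricSpace X] {a b z v : X}
    (h : dist a v + dist b z ≤ dist a z + dist b v) :
    |dstar a b z a - dstar a b z v| = dist a v := by
  simp only [dstar]
  have h1 := dist_triangle b a z
  rw [dist_self, min_eq_left (by linarith), min_eq_left (by linarith), zero_sub, abs_neg,
    abs_of_nonneg dist_nonneg]

theorem dstar_right {X : Type} [MetricSpace X] {a b z v : X}
    (h : dist a z + dist b v ≤ dist a v + dist b z) :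
    |dstar a b z b - dstar a b z v| = dist b v := by
  simp only [dstar]
  have h1 := dist_triangle a b z
  rw [dist_self, min_eq_right (by linarith), min_eq_right (by linarith)]
  rw [show 0 + (dist a z - dist b z) - (dist b v + (dist a z - dist b z)) = - dist b v by ring,
    abs_neg, abs_of_nonneg dist_nonneg]

theorem broom {X : Type} [MetricSpace X] (q : ℕ → X) (s a b : ℕ) (ha : a < s) (hb : b < s)
    (S : ℕ → Prop) (haS : S a) (hbS : ¬ S b) (hq : ∀ i < s, ∀ j < s, q i = q j → i = j)
    (h : ∀ x < s, ∀ y < s, S x → ¬ S y →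
      dist (q a) (q x) + dist (q b) (q y) ≤ dist (q a) (q b) + dist (q x) (q y)) :
    ∃ f : X → ℝ, LipschitzWith 1 f ∧
      (∀ x < s, S x → |f (q a) - f (q x)| = dist (q a) (q x)) ∧
      (∀ y < s, ¬ S y → |f (q b) - f (q y)| = dist (q b) (q y)) ∧
      |f (q a) - f (q b)| = dist (q a) (q b) := by
  classical
  let F : X → ℝ := fun v => if ∃ i < s, S i ∧ q i = v then dist (q a) v
    else dist (q a) (q b) - dist (q b) v
  have F1 : ∀ i < s, S i → F (q i) = dist (q a) (q i) := fun i hi hS => if_pos ⟨i, hi, hS, rfl⟩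
  have F2 : ∀ i < s, ¬ S i → F (q i) = dist (q a) (q b) - dist (q b) (q i) := by
    intro i hi hS
    refine if_neg ?_
    rintro ⟨j, hj, hSj, hji⟩
    exact hS (hq j hj i hi hji ▸ hSj)
  have hL : LipschitzOnWith 1 F (q '' {i | i < s}) := by
    apply LipschitzOnWith.of_dist_le_mul
    rintro _ ⟨x, hx, rfl⟩ _ ⟨y, hy, rfl⟩
    simp only [Set.mem_ofPred_eq] at hx hy
    rw [Real.dist_eq, NNReal.coe_one, one_mul, abs_le]
    have t1 := dist_triangle (q a) (q x) (q y)
    have t2 := dist_triangle (q a) (q y) (q x)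
    have t3 := dist_triangle (q b) (q x) (q y)
    have t4 := dist_triangle (q b) (q y) (q x)
    have t5 := dist_triangle (q a) (q x) (q b)
    have t6 := dist_triangle (q a) (q y) (q b)
    rw [dist_comm (q y) (q x)] at t2 t4
    rw [dist_comm (q x) (q b)] at t5
    rw [dist_comm (q y) (q b)] at t6
    by_cases hSx : S x <;> by_cases hSy : S y
    · rw [F1 x hx hSx, F1 y hy hSy]; constructor <;> linarith
    · rw [F1 x hx hSx, F2 y hy hSy]
      have := h x hx y hy hSx hSy
      constructor <;> linarith
    · rw [F2 x hx hSx, F1 y hy hSy]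
      have := h y hy x hx hSy hSx
      rw [dist_comm (q y) (q x)] at this
      constructor <;> linarith
    · rw [F2 x hx hSx, F2 y hy hSy]; constructor <;> linarith
  obtain ⟨f, hf, hfF⟩ := hL.extend_real
  have e : ∀ i < s, f (q i) = F (q i) := fun i hi => (hfF ⟨i, hi, rfl⟩).symm
  refine ⟨f, hf, ?_, ?_, ?_⟩
  · intro x hx hS
    rw [e a ha, e x hx, F1 a ha haS, F1 x hx hS, dist_self, zero_sub, abs_neg,
      abs_of_nonneg dist_nonneg]
  · intro y hy hS
    rw [e b hb, e y hy, F2 b hb hbS, F2 y hy hS, dist_self, sub_zero, sub_sub_cancel,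
      abs_of_nonneg dist_nonneg]
  · rw [e a ha, e b hb, F1 a ha haS, F2 b hb hbS, dist_self, dist_self, sub_zero, zero_sub,
      abs_neg, abs_of_nonneg dist_nonneg]

theorem caseA {X : Type} [MetricSpace X] (q : ℕ → X) (m : ℕ)
    (hq : ∀ i < 2 * m, ∀ j < 2 * m, q i = q j → i = j)
    (h12 : ∀ i j k l, i < j → j < k → k < l → l < 2 * m →
      dist (q i) (q j) + dist (q k) (q l) ≤ dist (q i) (q k) + dist (q j) (q l))
    (h32 : ∀ i j k l, i < j → j < k → k < l → l < 2 * m →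
      dist (q i) (q l) + dist (q j) (q k) ≤ dist (q i) (q k) + dist (q j) (q l)) :
    LCov q (2 * m) m := by
  classical
  have H : ∀ i, ∃ f : X → ℝ, i < m → LipschitzWith 1 f ∧
      (∀ x < 2 * m, (i ≤ x ∧ x < m + i) → |f (q i) - f (q x)| = dist (q i) (q x)) ∧
      (∀ y < 2 * m, ¬ (i ≤ y ∧ y < m + i) →
        |f (q (m + i)) - f (q y)| = dist (q (m + i)) (q y)) ∧
      |f (q i) - f (q (m + i))| = dist (q i) (q (m + i)) := by
    intro i
    by_cases hi : i < m
    · obtain ⟨f, hf⟩ := broom q (2 * m) i (m + i) (by omega) (by omega)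
        (fun x => i ≤ x ∧ x < m + i) (by omega) (by omega) hq (by
          rintro x hx y hy ⟨h1, h2⟩ h3
          rcases h1.eq_or_lt with rfl | h1
          · rw [dist_self, dist_comm (q (m + i)) (q y), zero_add]
            exact dist_comm (q i) (q y) ▸ by
              have := dist_triangle (q y) (q i) (q (m + i)); linarith
          · rcases lt_or_ge y i with h4 | h4
            · have := h32 y i x (m + i) h4 h1 h2 (by omega)
              rw [dist_comm (q (m + i)) (q y), dist_comm (q x) (q y)]; linarith
            · have h5 : m + i ≤ y := by omega
              rcases h5.eq_or_lt with rfl | h5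
              · rw [dist_self]
                have := dist_triangle (q i) (q (m + i)) (q x)
                rw [dist_comm (q x)]; linarith
              · have := h12 i x (m + i) y h1 h2 h5 hy
                linarith)
      exact ⟨f, fun _ => hf⟩
    · exact ⟨fun _ => 0, fun h => absurd h hi⟩
  choose f hf using H
  refine ⟨(Finset.range m).image f, Finset.card_image_le.trans (by simp), ?_, ?_⟩
  · intro g hg
    obtain ⟨i, hi, rfl⟩ := Finset.mem_image.1 hg
    exact (hf i (Finset.mem_range.1 hi)).1
  · intro i j hij hj
    have mem : ∀ i < m, f i ∈ (Finset.range m).image f := fun i hi =>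
      Finset.mem_image_of_mem _ (Finset.mem_range.2 hi)
    by_cases hi : i < m
    · by_cases hji : j < m + i
      · exact ⟨f i, mem i hi, (hf i hi).2.1 j hj ⟨hij.le, hji⟩⟩
      · obtain ⟨t, rfl⟩ : ∃ t, j = m + t := ⟨j - m, by omega⟩
        have ht : t < m := by omega
        refine ⟨f t, mem t ht, ?_⟩
        rw [abs_sub_comm, dist_comm]
        by_cases hti : i = t
        · subst hti
          rw [abs_sub_comm, dist_comm]
          exact (hf i hi).2.2.2
        · exact (hf t ht).2.2.1 i (by omega) (by omega)
    · obtain ⟨t, rfl⟩ : ∃ t, i = m + t := ⟨i - m, by omega⟩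
      have ht : t < m := by omega
      exact ⟨f t, mem t ht, (hf t ht).2.2.1 j hj (by omega)⟩

theorem caseB {X : Type} [MetricSpace X] (q : ℕ → X) (m : ℕ)
    (hq : ∀ i < 2 * m, ∀ j < 2 * m, q i = q j → i = j)
    (h12 : ∀ i j k l, i < j → j < k → k < l → l < 2 * m →
      dist (q i) (q j) + dist (q k) (q l) ≤ dist (q i) (q k) + dist (q j) (q l))
    (h23 : ∀ i j k l, i < j → j < k → k < l → l < 2 * m →
      dist (q i) (q k) + dist (q j) (q l) ≤ dist (q i) (q l) + dist (q j) (q k)) :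
    LCov q (2 * m) m := by
  classical
  have H : ∀ i, ∃ f : X → ℝ, i < m → LipschitzWith 1 f ∧
      (∀ x < 2 * m, (x ≤ i ∨ (m ≤ x ∧ x + i + 1 < 2 * m)) →
        |f (q i) - f (q x)| = dist (q i) (q x)) ∧
      (∀ y < 2 * m, ¬ (y ≤ i ∨ (m ≤ y ∧ y + i + 1 < 2 * m)) →
        |f (q (2 * m - 1 - i)) - f (q y)| = dist (q (2 * m - 1 - i)) (q y)) ∧
      |f (q i) - f (q (2 * m - 1 - i))| = dist (q i) (q (2 * m - 1 - i)) := by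
    intro i
    by_cases hi : i < m
    · obtain ⟨b, hb⟩ : ∃ b, b = 2 * m - 1 - i := ⟨_, rfl⟩
      rw [← hb]
      obtain ⟨f, hf⟩ := broom q (2 * m) i b (by omega) (by omega)
        (fun x => x ≤ i ∨ (m ≤ x ∧ x + i + 1 < 2 * m)) (by omega) (by omega) hq (by
          intro x hx y hy h1 h2
          by_cases hyb : y = b
          · subst hyb
            rw [dist_self]
            have := dist_triangle (q i) (q y) (q x)
            rw [dist_comm (q x)]; linarith
          by_cases hxi : x = i
          · subst hxi
            rw [dist_self]
            have := dist_triangle (q b) (q x) (q y)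
            rw [dist_comm (q x) (q b)]; linarith
          rcases h1 with h1 | h1
          · have hxi : x < i := by omega
            rcases lt_or_ge y m with hy' | hy'
            · have := h12 x i y b hxi (by omega) (by omega) (by omega)
              rw [dist_comm (q i) (q x), dist_comm (q b) (q y)]; linarith
            · have e1 := h12 x i b y hxi (by omega) (by omega) (by omega)
              have e2 := h23 x i b y hxi (by omega) (by omega) (by omega)
              rw [dist_comm (q i) (q x)]; linarith
          · rcases lt_or_ge y m with hy' | hy'
            · have := h23 i y x b (by omega) (by omega) (by omega) (by omega)
              rw [dist_comm (q b) (q y), dist_comm (q x) (q y)]; linarith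
            · have := h12 i x b y (by omega) (by omega) (by omega) (by omega)
              linarith)
      exact ⟨f, fun _ => hf⟩
    · exact ⟨fun _ => 0, fun h => absurd h hi⟩
  choose f hf using H
  refine ⟨(Finset.range m).image f, Finset.card_image_le.trans (by simp), ?_, ?_⟩
  · intro g hg
    obtain ⟨i, hi, rfl⟩ := Finset.mem_image.1 hg
    exact (hf i (Finset.mem_range.1 hi)).1
  · intro i j hij hj
    have mem : ∀ i < m, f i ∈ (Finset.range m).image f := fun i hi =>
      Finset.mem_image_of_mem _ (Finset.mem_range.2 hi)
    by_cases hi : i < m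
    · by_cases hjm : j < m
      · refine ⟨f j, mem j hjm, ?_⟩
        rw [abs_sub_comm, dist_comm]
        exact (hf j hjm).2.1 i (by omega) (by omega)
      · by_cases hji : j + i + 1 < 2 * m
        · exact ⟨f i, mem i hi, (hf i hi).2.1 j hj (by omega)⟩
        · obtain ⟨t, ht⟩ : ∃ t, t = 2 * m - 1 - j := ⟨_, rfl⟩
          have htj : j = 2 * m - 1 - t := by omega
          have htm : t < m := by omega
          refine ⟨f t, mem t htm, ?_⟩
          by_cases hti : i = t
          · subst hti; rw [htj]
            exact (hf i hi).2.2.2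
          · rw [abs_sub_comm, dist_comm, htj]
            exact (hf t htm).2.2.1 i (by omega) (by omega)
    · obtain ⟨t, ht⟩ : ∃ t, t = 2 * m - 1 - i := ⟨_, rfl⟩
      have hti : i = 2 * m - 1 - t := by omega
      have htm : t < m := by omega
      refine ⟨f t, mem t htm, ?_⟩
      have := (hf t htm).2.2.1 j hj (by omega)
      rwa [← hti] at this

theorem caseC (c : ℕ) : ∃ t : ℕ, c + 1 ≤ t ∧ ∀ (X : Type) [MetricSpace X] (q : ℕ → X),
    (∀ i j k l, i < j → j < k → k < l → l < t →
      dist (q i) (q k) + dist (q j) (q l) ≤ dist (q i) (q j) + dist (q k) (q l)) →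
    (∀ i j k l, i < j → j < k → k < l → l < t →
      dist (q i) (q l) + dist (q j) (q k) ≤ dist (q i) (q k) + dist (q j) (q l)) →
    LCov q t (t - (c + 1)) := by
  classical
  induction c with
  | zero =>
    refine ⟨1, le_rfl, fun X _ q _ _ => ⟨∅, by simp, by simp, ?_⟩⟩
    intro i j h1 h2; omega
  | succ c ih =>
    obtain ⟨t, hct, ht⟩ := ih
    refine ⟨2 * t + 2, by omega, fun X _ q h21 h32 => ?_⟩
    obtain ⟨G, hG, hGL, hGc⟩ := ht X (fun i => q (i + (t + 2)))
      (fun i j k l h1 h2 h3 h4 => h21 _ _ _ _ (by omega) (by omega) (by omega) (by omega))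
      (fun i j k l h1 h2 h3 h4 => h32 _ _ _ _ (by omega) (by omega) (by omega) (by omega))
    let F : ℕ → X → ℝ := fun k => dstar (q k) (q (k + 1)) (q (t + 1 + k))
    let f1 := dstar (q 1) (q 2) (q 0)
    let f2 := dstar (q 0) (q 2) (q (t + 2))
    refine ⟨insert f1 (insert f2 ((Finset.Ico 2 (t + 1)).image F ∪ G)), ?_, ?_, ?_⟩
    · have e1 := Finset.card_insert_le f1 (insert f2 ((Finset.Ico 2 (t + 1)).image F ∪ G))
      have e2 := Finset.card_insert_le f2 ((Finset.Ico 2 (t + 1)).image F ∪ G)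
      have e3 := Finset.card_union_le ((Finset.Ico 2 (t + 1)).image F) G
      have e4 : ((Finset.Ico 2 (t + 1)).image F).card ≤ _ := Finset.card_image_le
      rw [Nat.card_Ico] at e4
      omega
    · intro f hf
      simp only [Finset.mem_insert, Finset.mem_union, Finset.mem_image] at hf
      rcases hf with rfl | rfl | ⟨k, -, rfl⟩ | hf
      · exact dstar_lip _ _ _
      · exact dstar_lip _ _ _
      · exact dstar_lip _ _ _
      · exact hGL f hf
    · have m1 : f1 ∈ insert f1 (insert f2 ((Finset.Ico 2 (t + 1)).image F ∪ G)) := by simp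
      have m2 : f2 ∈ insert f1 (insert f2 ((Finset.Ico 2 (t + 1)).image F ∪ G)) := by simp
      have m3 : ∀ k, 2 ≤ k → k < t + 1 →
          F k ∈ insert f1 (insert f2 ((Finset.Ico 2 (t + 1)).image F ∪ G)) := by
        intro k h1 h2
        refine Finset.mem_insert_of_mem (Finset.mem_insert_of_mem (Finset.mem_union_left _ ?_))
        exact Finset.mem_image_of_mem _ (Finset.mem_Ico.2 ⟨h1, h2⟩)
      have m4 : ∀ f ∈ G, f ∈ insert f1 (insert f2 ((Finset.Ico 2 (t + 1)).image F ∪ G)) := by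
        intro f hf; simp [hf]
      generalize insert f1 (insert f2 ((Finset.Ico 2 (t + 1)).image F ∪ G)) = GG at *
      have h32' : ∀ i j k l, i < j → j < k → k ≤ l → l < 2 * t + 2 →
          dist (q i) (q l) + dist (q j) (q k) ≤ dist (q i) (q k) + dist (q j) (q l) := by
        intro i j k l h1 h2 h3 h4
        rcases h3.eq_or_lt with rfl | h3
        · exact le_rfl
        · exact h32 i j k l h1 h2 h3 h4
      -- right centre, point to the left
      have RL : ∀ v k, v < k → 2 ≤ k → k < t + 1 →
          |F k (q v) - F k (q (k + 1))| = dist (q v) (q (k + 1)) := by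
        intro v k h1 h2 h3
        rw [abs_sub_comm, dist_comm]
        apply dstar_right
        have := h21 v k (k + 1) (t + 1 + k) h1 (by omega) (by omega) (by omega)
        rw [dist_comm (q (k + 1)) (q v), dist_comm (q k) (q v)]; linarith
      have RR : ∀ v k, k + 1 < v → v ≤ t + 1 + k → 2 ≤ k → k < t + 1 →
          |F k (q (k + 1)) - F k (q v)| = dist (q (k + 1)) (q v) := by
        intro v k h1 h2 h3 h4
        apply dstar_right
        have := h32' k (k + 1) v (t + 1 + k) (by omega) h1 h2 (by omega)
        linarith
      have LR : ∀ v k, t + 1 + k ≤ v → v < 2 * t + 2 → 2 ≤ k → k < t + 1 →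
          |F k (q k) - F k (q v)| = dist (q k) (q v) := by
        intro v k h1 h2 h3 h4
        apply dstar_left
        have := h32' k (k + 1) (t + 1 + k) v (by omega) (by omega) h1 h2
        linarith
      intro i j hij hj
      by_cases hi : t + 2 ≤ i
      · obtain ⟨f, hf, hfe⟩ := hGc (i - (t + 2)) (j - (t + 2)) (by omega) (by omega)
        refine ⟨f, m4 f hf, ?_⟩
        have e1 : i - (t + 2) + (t + 2) = i := by omega
        have e2 : j - (t + 2) + (t + 2) = j := by omega
        simpa only [e1, e2] using hfe
      by_cases hi0 : i = 0
      · subst hi0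
        by_cases hj1 : t + 2 ≤ j
        · refine ⟨f2, m2, dstar_left ?_⟩
          have := h32' 0 2 (t + 2) j (by omega) (by omega) hj1 hj
          linarith
        by_cases hj2 : j = 1
        · subst hj2
          refine ⟨f1, m1, ?_⟩
          rw [abs_sub_comm, dist_comm]
          exact dstar_left le_rfl
        by_cases hj3 : j = 2
        · subst hj3
          refine ⟨f1, m1, ?_⟩
          rw [abs_sub_comm, dist_comm]
          exact dstar_right le_rfl
        obtain ⟨k, rfl⟩ : ∃ k, j = k + 1 := ⟨j - 1, by omega⟩
        exact ⟨F k, m3 k (by omega) (by omega), RL 0 k (by omega) (by omega) (by omega)⟩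
      by_cases hi1 : i = 1
      · subst hi1
        by_cases hj2 : j = 2
        · subst hj2
          refine ⟨f2, m2, ?_⟩
          rw [abs_sub_comm, dist_comm]
          apply dstar_right
          have e1 := h21 0 1 2 (t + 2) (by omega) (by omega) (by omega) (by omega)
          have e2 := h32 0 1 2 (t + 2) (by omega) (by omega) (by omega) (by omega)
          rw [dist_comm (q 2) (q 1)]; linarith
        · refine ⟨f1, m1, dstar_left ?_⟩
          have e1 := h21 0 1 2 j (by omega) (by omega) (by omega) (by omega)
          rw [dist_comm (q 2) (q 0), dist_comm (q 1) (q 0)]; linarith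
      by_cases hj1 : j < t + 2
      · by_cases hji : j = i + 1
        · subst hji
          by_cases hi2 : i = 2
          · subst hi2
            refine ⟨f2, m2, dstar_right ?_⟩
            have := h32 0 2 (2 + 1) (t + 2) (by omega) (by omega) (by omega) (by omega)
            linarith
          · obtain ⟨k, rfl⟩ : ∃ k, i = k + 1 := ⟨i - 1, by omega⟩
            exact ⟨F k, m3 k (by omega) (by omega), RR _ k (by omega) (by omega) (by omega)
              (by omega)⟩
        · obtain ⟨k, rfl⟩ : ∃ k, j = k + 1 := ⟨j - 1, by omega⟩
          exact ⟨F k, m3 k (by omega) (by omega), RL _ k (by omega) (by omega) (by omega)⟩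
      · by_cases hji : t + 1 + i ≤ j
        · exact ⟨F i, m3 i (by omega) (by omega), LR _ i (by omega) (by omega) (by omega)
              (by omega)⟩
        · by_cases hi2 : i = 2
          · subst hi2
            obtain rfl : j = t + 2 := by omega
            exact ⟨f2, m2, dstar_right le_rfl⟩
          · obtain ⟨k, rfl⟩ : ∃ k, i = k + 1 := ⟨i - 1, by omega⟩
            exact ⟨F k, m3 k (by omega) (by omega), RR _ k (by omega) (by omega) (by omega)
              (by omega)⟩

theorem caseD (c : ℕ) : ∃ t : ℕ, c + 1 ≤ t ∧ ∀ (X : Type) [MetricSpace X] (q : ℕ → X),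
    (∀ i j k l, i < j → j < k → k < l → l < t →
      dist (q i) (q l) + dist (q j) (q k) ≤ dist (q i) (q j) + dist (q k) (q l)) →
    (∀ i j k l, i < j → j < k → k < l → l < t →
      dist (q i) (q k) + dist (q j) (q l) ≤ dist (q i) (q l) + dist (q j) (q k)) →
    LCov q t (t - (c + 1)) := by
  classical
  induction c with
  | zero =>
    refine ⟨1, le_rfl, fun X _ q _ _ => ⟨∅, by simp, by simp, ?_⟩⟩
    intro i j h1 h2; omega
  | succ c ih =>
    obtain ⟨t, hct, ht⟩ := ih
    refine ⟨3 * t + 1, by omega, fun X _ q h31 h23 => ?_⟩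
    obtain ⟨G, hG, hGL, hGc⟩ := ht X (fun i => q (i + (2 * t + 1)))
      (fun i j k l h1 h2 h3 h4 => h31 _ _ _ _ (by omega) (by omega) (by omega) (by omega))
      (fun i j k l h1 h2 h3 h4 => h23 _ _ _ _ (by omega) (by omega) (by omega) (by omega))
    -- index shifted by one: `i` stands for `i + 1`
    let U : ℕ → X → ℝ := fun i => dstar (q (2 * i + 1)) (q (2 * i + 2)) (q (2 * i))
    let T : ℕ → X → ℝ := fun i => dstar (q (2 * i)) (q (2 * i + 2)) (q (3 * t - i))
    refine ⟨(Finset.range t).image U ∪ ((Finset.range t).image T ∪ G), ?_, ?_, ?_⟩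
    · have e1 := Finset.card_union_le ((Finset.range t).image U) ((Finset.range t).image T ∪ G)
      have e2 := Finset.card_union_le ((Finset.range t).image T) G
      have e3 : ((Finset.range t).image U).card ≤ _ := Finset.card_image_le
      have e4 : ((Finset.range t).image T).card ≤ _ := Finset.card_image_le
      rw [Finset.card_range] at e3 e4
      omega
    · intro f hf
      simp only [Finset.mem_union, Finset.mem_image] at hf
      rcases hf with ⟨k, -, rfl⟩ | ⟨k, -, rfl⟩ | hf
      · exact dstar_lip _ _ _
      · exact dstar_lip _ _ _
      · exact hGL f hf
    · have mU : ∀ k, k < t → U k ∈ (Finset.range t).image U ∪ ((Finset.range t).image T ∪ G) :=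
        fun k hk => Finset.mem_union_left _ (Finset.mem_image_of_mem _ (Finset.mem_range.2 hk))
      have mT : ∀ k, k < t → T k ∈ (Finset.range t).image U ∪ ((Finset.range t).image T ∪ G) :=
        fun k hk => Finset.mem_union_right _ (Finset.mem_union_left _
          (Finset.mem_image_of_mem _ (Finset.mem_range.2 hk)))
      have mG : ∀ f ∈ G, f ∈ (Finset.range t).image U ∪ ((Finset.range t).image T ∪ G) :=
        fun k hk => Finset.mem_union_right _ (Finset.mem_union_right _ hk)
      generalize (Finset.range t).image U ∪ ((Finset.range t).image T ∪ G) = GG at *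
      have h23' : ∀ i j k l, i < j → j < k → k ≤ l → l < 3 * t + 1 →
          dist (q i) (q k) + dist (q j) (q l) ≤ dist (q i) (q l) + dist (q j) (q k) := by
        intro i j k l h1 h2 h3 h4
        rcases h3.eq_or_lt with rfl | h3
        · exact le_rfl
        · exact h23 i j k l h1 h2 h3 h4
      have h23'' : ∀ i j k l, i ≤ j → j < k → k < l → l < 3 * t + 1 →
          dist (q i) (q k) + dist (q j) (q l) ≤ dist (q i) (q l) + dist (q j) (q k) := by
        intro i j k l h1 h2 h3 h4
        rcases h1.eq_or_lt with rfl | h1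
        · linarith
        · exact h23 i j k l h1 h2 h3 h4
      intro i j hij hj
      by_cases hi : 2 * t + 1 ≤ i
      · obtain ⟨f, hf, hfe⟩ := hGc (i - (2 * t + 1)) (j - (2 * t + 1)) (by omega) (by omega)
        refine ⟨f, mG f hf, ?_⟩
        have e1 : i - (2 * t + 1) + (2 * t + 1) = i := by omega
        have e2 : j - (2 * t + 1) + (2 * t + 1) = j := by omega
        simpa only [e1, e2] using hfe
      by_cases hj1 : j < 2 * t + 1
      · obtain ⟨k, hk | hk⟩ : ∃ k, j = 2 * k + 1 ∨ j = 2 * k + 2 := ⟨(j - 1) / 2, by omega⟩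
        · subst hk
          refine ⟨U k, mU k (by omega), ?_⟩
          rw [abs_sub_comm, dist_comm]
          apply dstar_left
          have := h23'' i (2 * k) (2 * k + 1) (2 * k + 2) (by omega) (by omega) (by omega)
            (by omega)
          rw [dist_comm (q (2 * k + 1)) (q i), dist_comm (q (2 * k + 2)) (q (2 * k)),
            dist_comm (q (2 * k + 1)) (q (2 * k)), dist_comm (q (2 * k + 2)) (q i)]
          linarith
        · subst hk
          by_cases hi1 : i = 2 * k
          · subst hi1
            refine ⟨U k, mU k (by omega), ?_⟩
            rw [abs_sub_comm, dist_comm]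
            exact dstar_right le_rfl
          · refine ⟨T k, mT k (by omega), ?_⟩
            rw [abs_sub_comm, dist_comm]
            apply dstar_right
            by_cases hi2 : i = 2 * k + 1
            · have := h31 (2 * k) i (2 * k + 2) (3 * t - k) (by omega) (by omega) (by omega)
                (by omega)
              rw [dist_comm (q (2 * k + 2)) (q i)]; linarith
            · have e1 := h31 i (2 * k) (2 * k + 2) (3 * t - k) (by omega) (by omega) (by omega)
                (by omega)
              have e2 := h23 i (2 * k) (2 * k + 2) (3 * t - k) (by omega) (by omega) (by omega)
                (by omega)
              rw [dist_comm (q (2 * k + 2)) (q i), dist_comm (q (2 * k)) (q i)]; linarith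
      · by_cases hodd : ∃ k, i = 2 * k + 1
        · obtain ⟨k, rfl⟩ := hodd
          refine ⟨U k, mU k (by omega), dstar_left ?_⟩
          have e1 := h31 (2 * k) (2 * k + 1) (2 * k + 2) j (by omega) (by omega) (by omega)
            (by omega)
          have e2 := h23 (2 * k) (2 * k + 1) (2 * k + 2) j (by omega) (by omega) (by omega)
            (by omega)
          rw [dist_comm (q (2 * k + 2)) (q (2 * k)), dist_comm (q (2 * k + 1)) (q (2 * k))]
          linarith
        · obtain ⟨p, rfl⟩ : ∃ p, i = 2 * p :=
            ⟨i / 2, by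
              by_contra h
              exact hodd ⟨i / 2, by omega⟩⟩
          by_cases hjp : j ≤ 3 * t - p
          · refine ⟨T p, mT p (by omega), dstar_left ?_⟩
            have := h23' (2 * p) (2 * p + 2) j (3 * t - p) (by omega) (by omega) hjp (by omega)
            linarith
          · obtain ⟨k, rfl⟩ : ∃ k, p = k + 1 := ⟨p - 1, by omega⟩
            refine ⟨T k, mT k (by omega), ?_⟩
            have := h23' (2 * k) (2 * k + 2) (3 * t - k) j (by omega) (by omega) (by omega) hj
            exact dstar_right (by linarith)

theorem final_embed {X : Type} [MetricSpace X] [Fintype X] (q : ℕ → X) (s k n c : ℕ)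
    (hn : Fintype.card X = n) (hq : ∀ i < s, ∀ j < s, q i = q j → i = j)
    (hcov : LCov q s k) (hk : k + c ≤ s) (hn1 : c + 1 ≤ n) :
    ∃ f : X → LinfSpace (n - c), ∀ x y : X, dist (f x) (f y) = dist x y := by
  classical
  obtain ⟨G, hG, hGL, hGc⟩ := hcov
  set S : Finset X := (Finset.range s).image q with hS
  have hScard : S.card = s := by
    rw [hS, Finset.card_image_of_injOn, Finset.card_range]
    intro i hi j hj hij
    exact hq i (by simpa using hi) j (by simpa using hj) hij
  set GG : Finset (X → ℝ) := G ∪ Sᶜ.image (fun x v => dist x v) with hGG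
  have hsn : s ≤ n := by rw [← hScard, ← hn]; exact Finset.card_le_univ _
  have hcard : GG.card ≤ n - c := by
    have e1 : GG.card ≤ G.card + (Sᶜ.image (fun (x v : X) => dist x v)).card :=
      Finset.card_union_le _ _
    have e2 : (Sᶜ.image (fun (x v : X) => dist x v)).card ≤ _ := Finset.card_image_le
    rw [Finset.card_compl, hScard, hn] at e2
    omega
  have hL : ∀ f ∈ GG, LipschitzWith 1 f := by
    intro f hf
    rcases Finset.mem_union.1 hf with hf | hf
    · exact hGL f hf
    · obtain ⟨x, -, rfl⟩ := Finset.mem_image.1 hf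
      exact LipschitzWith.dist_right x
  have hC : ∀ x y, x ≠ y → ∃ f ∈ GG, |f x - f y| = dist x y := by
    have star : ∀ x y, x ∉ S → ∃ f ∈ GG, |f x - f y| = dist x y := by
      intro x y hx
      refine ⟨fun v => dist x v, Finset.mem_union_right _
        (Finset.mem_image_of_mem _ (Finset.mem_compl.2 hx)), ?_⟩
      simp
    intro x y hxy
    by_cases hx : x ∈ S
    · by_cases hy : y ∈ S
      · obtain ⟨i, hi, rfl⟩ := Finset.mem_image.1 hx
        obtain ⟨j, hj, rfl⟩ := Finset.mem_image.1 hy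
        rw [Finset.mem_range] at hi hj
        rcases lt_trichotomy i j with h | h | h
        · obtain ⟨f, hf, e⟩ := hGc i j h hj
          exact ⟨f, Finset.mem_union_left _ hf, e⟩
        · exact absurd (h ▸ rfl) hxy
        · obtain ⟨f, hf, e⟩ := hGc j i h hi
          refine ⟨f, Finset.mem_union_left _ hf, ?_⟩
          rwa [abs_sub_comm, dist_comm]
      · obtain ⟨f, hf, e⟩ := star y x hy
        refine ⟨f, hf, ?_⟩
        rwa [abs_sub_comm, dist_comm]
    · exact star x y hx
  let e := GG.equivFin
  let F : Fin (n - c) → X → ℝ := fun i =>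
    if h : (i : ℕ) < GG.card then (e.symm ⟨i, h⟩ : X → ℝ) else fun _ => 0
  have hFL : ∀ i x y, |F i x - F i y| ≤ dist x y := by
    intro i x y
    by_cases h : (i : ℕ) < GG.card
    · have := (hL _ (e.symm ⟨i, h⟩).2).dist_le_mul x y
      simpa [F, h, Real.dist_eq] using this
    · simp [F, h]
  have hFC : ∀ x y, x ≠ y → ∃ i, |F i x - F i y| = dist x y := by
    intro x y hxy
    obtain ⟨f, hf, hfe⟩ := hC x y hxy
    refine ⟨⟨e ⟨f, hf⟩, (e ⟨f, hf⟩).2.trans_le hcard⟩, ?_⟩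
    simpa [F] using hfe
  have : Nonempty (Fin (n - c)) := ⟨⟨0, by omega⟩⟩
  refine ⟨fun x => WithLp.toLp ⊤ (fun i => F i x), fun x y => ?_⟩
  rw [PiLp.dist_eq_iSup]
  by_cases hxy : x = y
  · subst hxy; simp
  apply le_antisymm
  · apply ciSup_le
    intro i
    rw [Real.dist_eq]
    exact hFL i x y
  · obtain ⟨i, hi⟩ := hFC x y hxy
    rw [← hi]
    have := le_ciSup (f := fun i => dist (F i x) (F i y)) (Set.finite_range _).bddAbove i
    simpa only [Real.dist_eq] using this

theorem hom_seq (s : ℕ) : ∃ N : ℕ, ∀ n : ℕ, N ≤ n →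
    ∀ (X : Type) [MetricSpace X] [Fintype X], Fintype.card X = n →
    ∃ q : ℕ → X, (∀ i < s, ∀ j < s, q i = q j → i = j) ∧ ∃ c : Fin 3 → Prop,
      ∀ i j k l, i < j → j < k → k < l → l < s →
      (c 0 ↔ dist (q i) (q j) + dist (q k) (q l) ≤ dist (q i) (q k) + dist (q j) (q l)) ∧
      (c 1 ↔ dist (q i) (q k) + dist (q j) (q l) ≤ dist (q i) (q l) + dist (q j) (q k)) ∧
      (c 2 ↔ dist (q i) (q l) + dist (q j) (q k) ≤ dist (q i) (q j) + dist (q k) (q l)) := by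
  classical
  obtain ⟨N, hN⟩ := ramsey_aux (Fin 3 → Prop) 4 s
  refine ⟨N + 1, fun n hn X _ _ hX => ?_⟩
  let eX : X ≃ Fin n := Fintype.equivFinOfCardEq hX
  let p : ℕ → X := fun i => eX.symm ⟨i % n, Nat.mod_lt _ (by omega)⟩
  have hp : ∀ i < n, ∀ j < n, p i = p j → i = j := by
    intro i hi j hj h
    have := eX.symm.injective h
    simpa [Nat.mod_eq_of_lt hi, Nat.mod_eq_of_lt hj] using this
  let R : (Fin 4 → ℕ) → Fin 3 → Prop := fun v => 
    ![dist (p (v 0)) (p (v 1)) + dist (p (v 2)) (p (v 3)) ≤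
        dist (p (v 0)) (p (v 2)) + dist (p (v 1)) (p (v 3)),
      dist (p (v 0)) (p (v 2)) + dist (p (v 1)) (p (v 3)) ≤
        dist (p (v 0)) (p (v 3)) + dist (p (v 1)) (p (v 2)),
      dist (p (v 0)) (p (v 3)) + dist (p (v 1)) (p (v 2)) ≤
        dist (p (v 0)) (p (v 1)) + dist (p (v 2)) (p (v 3))]
  obtain ⟨B, hB, hBc, c, hc⟩ := hN (Finset.range n) (by simp; omega)
    (fun T => if h : T.card = 4 then R (T.orderEmbOfFin h) else fun _ => False)
  let o : ℕ → ℕ := fun i => if h : i < s then B.orderEmbOfFin hBc ⟨i, h⟩ else 0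
  have oB : ∀ i < s, o i ∈ B := by
    intro i hi
    simp only [o, hi, dite_true]
    exact B.orderEmbOfFin_mem hBc _
  have omono : ∀ i j, i < j → j < s → o i < o j := by
    intro i j hij hj
    simp only [o, hj, hij.trans hj, dite_true]
    exact (B.orderEmbOfFin hBc).strictMono hij
  have on : ∀ i < s, o i < n := fun i hi => Finset.mem_range.1 (hB (oB i hi))
  refine ⟨fun i => p (o i), ?_, c, ?_⟩
  · intro i hi j hj h
    have := hp _ (on i hi) _ (on j hj) h
    rcases lt_trichotomy i j with h' | h' | h'
    · have := omono i j h' hj; omega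
    · exact h'
    · have := omono j i h' hi; omega
  · intro i j k l hij hjk hkl hl
    have a1 := omono i j hij (by omega)
    have a2 := omono j k hjk (by omega)
    have a3 := omono k l hkl (by omega)
    have hT4 : ({o i, o j, o k, o l} : Finset ℕ).card = 4 := by
      rw [Finset.card_insert_of_notMem, Finset.card_insert_of_notMem,
        Finset.card_insert_of_notMem, Finset.card_singleton] <;>
      simp only [Finset.mem_insert, Finset.mem_singleton] <;> omega
    have hTB : ({o i, o j, o k, o l} : Finset ℕ) ⊆ B := by
      intro x hx
      simp only [Finset.mem_insert, Finset.mem_singleton] at hx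
      rcases hx with rfl | rfl | rfl | rfl <;> exact oB _ (by omega)
    have hcT := hc _ hTB hT4
    rw [dif_pos hT4] at hcT
    have hu := Finset.orderEmbOfFin_unique hT4 (f := ![o i, o j, o k, o l])
      (by intro x; fin_cases x <;> simp)
      (by
        rw [Fin.strictMono_iff_lt_succ]
        intro x; fin_cases x <;> simp [a1, a2, a3])
    rw [← hu] at hcT
    rw [← hcT]
    simp [R]

/-- For every positive integer `c` there exists `N` such that for all `n ≥ N`,
every metric space on `n` points admits an isometric embedding into `l_∞^{n-c}`. -/
theorem exists_isometric_embedding_linf_sub (c : ℕ) (hc : 0 < c) :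
    ∃ N : ℕ, ∀ n : ℕ, N ≤ n →
      ∀ (X : Type) [MetricSpace X] [Fintype X], Fintype.card X = n →
        ∃ f : X → LinfSpace (n - c), ∀ x y : X, dist (f x) (f y) = dist x y := by
  obtain ⟨t1, ht1, hC⟩ := caseC c
  obtain ⟨t2, ht2, hD⟩ := caseD c
  obtain ⟨N, hN⟩ := hom_seq (2 * c + t1 + t2 + 5)
  refine ⟨N + c + 1, fun n hn X _ _ hX => ?_⟩
  obtain ⟨q, hq, cc, H⟩ := hN n (by omega) X hX
  by_cases h0 : cc 0
  · by_cases h1 : cc 1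
    · refine final_embed q (2 * c) c n c hX (fun i hi j hj => hq i (by omega) j (by omega))
        (caseB q c (fun i hi j hj => hq i (by omega) j (by omega)) ?_ ?_) (by omega) (by omega)
      · intro i j k l a1 a2 a3 a4
        exact (H i j k l a1 a2 a3 (by omega)).1.1 h0
      · intro i j k l a1 a2 a3 a4
        exact (H i j k l a1 a2 a3 (by omega)).2.1.1 h1
    · refine final_embed q (2 * c) c n c hX (fun i hi j hj => hq i (by omega) j (by omega))
        (caseA q c (fun i hi j hj => hq i (by omega) j (by omega)) ?_ ?_) (by omega) (by omega)
      · intro i j k l a1 a2 a3 a4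
        exact (H i j k l a1 a2 a3 (by omega)).1.1 h0
      · intro i j k l a1 a2 a3 a4
        exact (not_le.1 (fun h => h1 ((H i j k l a1 a2 a3 (by omega)).2.1.2 h))).le
  · have H0 : ∀ i j k l, i < j → j < k → k < l → l < 2 * c + t1 + t2 + 5 →
        dist (q i) (q k) + dist (q j) (q l) < dist (q i) (q j) + dist (q k) (q l) := by
      intro i j k l a1 a2 a3 a4
      exact not_le.1 (fun h => h0 ((H i j k l a1 a2 a3 a4).1.2 h))
    by_cases h2 : cc 2
    · by_cases h1 : cc 1
      · refine final_embed q t2 (t2 - (c + 1)) n c hX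
          (fun i hi j hj => hq i (by omega) j (by omega)) (hD X q ?_ ?_) (by omega) (by omega)
        · intro i j k l a1 a2 a3 a4
          exact (H i j k l a1 a2 a3 (by omega)).2.2.1 h2
        · intro i j k l a1 a2 a3 a4
          exact (H i j k l a1 a2 a3 (by omega)).2.1.1 h1
      · refine final_embed q t1 (t1 - (c + 1)) n c hX
          (fun i hi j hj => hq i (by omega) j (by omega)) (hC X q ?_ ?_) (by omega) (by omega)
        · intro i j k l a1 a2 a3 a4
          exact (H0 i j k l a1 a2 a3 (by omega)).le
        · intro i j k l a1 a2 a3 a4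
          exact (not_le.1 (fun h => h1 ((H i j k l a1 a2 a3 (by omega)).2.1.2 h))).le
    · exfalso
      have H2 : ∀ i j k l, i < j → j < k → k < l → l < 2 * c + t1 + t2 + 5 →
          dist (q i) (q j) + dist (q k) (q l) < dist (q i) (q l) + dist (q j) (q k) := by
        intro i j k l a1 a2 a3 a4
        exact not_le.1 (fun h => h2 ((H i j k l a1 a2 a3 a4).2.2.2 h))
      have e1 := H2 0 1 2 3 (by omega) (by omega) (by omega) (by omega)
      have e2 := H2 1 2 3 4 (by omega) (by omega) (by omega) (by omega)
      have e3 := H0 0 1 3 4 (by omega) (by omega) (by omega) (by omega)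
      linarith
end

section
/- Fix n and N. If every generic metric space on n points admits an isometric embedding into l_∞^N, then every metric space on n points admits an isometric embedding into l_∞^N. -/
/-- A metric space is *generic* if the family of pairwise distances between
distinct points (indexed by unordered pairs of distinct points) is linearly
independent over `ℚ`. -/
def IsGeneric (X : Type*) [MetricSpace X] : Prop :=
  LinearIndependent ℚ (fun p : {p : Sym2 X // ¬ p.IsDiag} =>
    Sym2.lift ⟨dist, fun a b => dist_comm a b⟩ p.1)

lemma exists_indep_in_intervals {ι : Type} [Finite ι] (a b : ι → ℝ) (ha : ∀ i, 0 < a i)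
    (hab : ∀ i, a i < b i) :
    ∃ v : ι → ℝ, LinearIndependent ℚ v ∧ ∀ i, a i < v i ∧ v i < b i := by
  let B := Module.Basis.ofVectorSpace ℚ ℝ
  have hinf : Infinite (Module.Basis.ofVectorSpaceIndex ℚ ℝ) := by
    rw [Cardinal.infinite_iff, B.mk_eq_rank'', Real.rank_rat_real]
    exact Cardinal.aleph0_le_continuum
  have := Fintype.ofFinite ι
  let e : ι ↪ Module.Basis.ofVectorSpaceIndex ℚ ℝ :=
    (Fintype.equivFin ι).toEmbedding.trans
      (Fin.valEmbedding.trans (Infinite.natEmbedding _))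
  have hB : LinearIndependent ℚ (fun i => B (e i)) := B.linearIndependent.comp e e.injective
  have hq : ∀ i, ∃ q : ℚ, a i < q * B (e i) ∧ q * B (e i) < b i := by
    intro i
    have hne : B (e i) ≠ 0 := B.ne_zero _
    rcases lt_or_gt_of_ne hne with h | h
    · obtain ⟨q, h1, h2⟩ := exists_rat_btwn (div_lt_div_of_neg_of_lt h (hab i))
      exact ⟨q, by rwa [lt_div_iff_of_neg h] at h2, by rwa [div_lt_iff_of_neg h] at h1⟩
    · obtain ⟨q, h1, h2⟩ := exists_rat_btwn (div_lt_div_of_pos_right (hab i) h)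
      exact ⟨q, by rwa [div_lt_iff₀ h] at h1, by rwa [lt_div_iff₀ h] at h2⟩
  choose q hq1 hq2 using hq
  have hq0 : ∀ i, q i ≠ 0 := by
    intro i h0
    have := hq1 i
    rw [h0] at this
    have := ha i
    simp at *
    linarith
  refine ⟨fun i => q i * B (e i), ?_, fun i => ⟨hq1 i, hq2 i⟩⟩
  have := hB.units_smul (fun i => Units.mk0 (q i) (hq0 i))
  convert this using 1
  ext i
  simp [Units.smul_def, Rat.smul_def]

lemma exists_generic_near (X : Type) [m0 : MetricSpace X] [Finite X] (ε : ℝ) (hε : 0 < ε) :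
    ∃ m : MetricSpace X, @IsGeneric X m ∧ ∀ x y : X, |m.dist x y - m0.dist x y| ≤ 2 * ε := by
  classical
  obtain ⟨v, hv, hv2⟩ := exists_indep_in_intervals (ι := {p : Sym2 X // ¬ p.IsDiag})
    (fun p => Sym2.lift ⟨dist, fun a b => dist_comm a b⟩ p.1 + ε)
    (fun p => Sym2.lift ⟨dist, fun a b => dist_comm a b⟩ p.1 + 2 * ε)
    (by
      rintro ⟨p, hp⟩
      induction p with | _ x y
      simp only [Sym2.lift_mk]
      positivity)
    (by intro p; linarith)
  let d : X → X → ℝ := fun x y => if h : x = y then 0 else v ⟨s(x, y), by simpa using h⟩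
  have d1 : ∀ x, d x x = 0 := fun x => by simp [d]
  have d2 : ∀ x y, x ≠ y → dist x y + ε < d x y ∧ d x y < dist x y + 2 * ε := by
    intro x y h
    have := hv2 ⟨s(x, y), by simpa using h⟩
    simpa [d, h] using this
  have d3 : ∀ x y, d x y = d y x := by
    intro x y
    by_cases h : x = y
    · rw [h]
    · have h' : ¬ y = x := fun e => h e.symm
      simp only [d, h, h', dif_neg, not_false_eq_true]
      congr 2
      exact Sym2.eq_swap
  let m : MetricSpace X :=
    { dist := d
      dist_self := d1
      dist_comm := d3
      dist_triangle := by
        intro x y z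
        by_cases hxy : x = y
        · subst hxy; rw [d1]; simp
        by_cases hyz : y = z
        · subst hyz; rw [d1]; simp
        have h1 := d2 x y hxy
        have h2 := d2 y z hyz
        have p1 := dist_nonneg (x := x) (y := y)
        have p2 := dist_nonneg (x := y) (y := z)
        by_cases hxz : x = z
        · subst hxz; rw [d1]; linarith
        have h3 := d2 x z hxz
        have := dist_triangle x y z
        linarith
      eq_of_dist_eq_zero := by
        intro x y hxy
        by_contra hne
        have h1 := d2 x y hne
        have p1 := dist_nonneg (x := x) (y := y)
        have : d x y = 0 := hxy
        linarith }
  refine ⟨m, ?_, ?_⟩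
  · unfold IsGeneric
    convert hv using 1
    ext ⟨p, hp⟩
    induction p with | _ x y
    have hxy : ¬ x = y := by simpa using hp
    change d x y = _
    simp [d, hxy]
  · intro x y
    change |d x y - m0.dist x y| ≤ _
    by_cases hxy : x = y
    · subst hxy; rw [d1, m0.dist_self]; simp; positivity
    · have h1 := d2 x y hxy
      obtain ⟨h1, h3⟩ := h1
      rw [abs_le]; constructor <;> linarith

/-- If every generic metric space on `n` points embeds isometrically into `l_∞^N`,
then every metric space on `n` points embeds isometrically into `l_∞^N`. -/
theorem embedding_of_generic_embedding (n N : ℕ)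
    (h : ∀ (X : Type) [MetricSpace X] [Fintype X], Fintype.card X = n → IsGeneric X →
      ∃ f : X → LinfSpace N, ∀ x y : X, dist (f x) (f y) = dist x y) :
    ∀ (X : Type) [MetricSpace X] [Fintype X], Fintype.card X = n →
      ∃ f : X → LinfSpace N, ∀ x y : X, dist (f x) (f y) = dist x y := by
  intro X _ _ hX
  rcases isEmpty_or_nonempty X with hE | ⟨⟨x0⟩⟩
  · exact ⟨fun _ => 0, fun x => hE.elim x⟩
  have key : ∀ k : ℕ, ∃ g : X → LinfSpace N, g x0 = 0 ∧
      ∀ x y, |dist (g x) (g y) - dist x y| ≤ 2 * (1 / ((k : ℝ) + 1)) := by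
    intro k
    obtain ⟨m, hm, hd⟩ := exists_generic_near X (1 / ((k : ℝ) + 1)) (by positivity)
    obtain ⟨f, hf⟩ := @h X m _ hX hm
    refine ⟨fun x => f x - f x0, by simp, fun x y => ?_⟩
    rw [dist_sub_right, hf]
    exact hd x y
  choose g hg0 hg using key
  have hK : IsCompact (Set.pi Set.univ
      (fun x : X => Metric.closedBall (0 : LinfSpace N) (dist x x0 + 2))) :=
    isCompact_univ_pi fun x => isCompact_closedBall _ _
  have hmem : ∀ k, g k ∈ Set.pi Set.univ
      (fun x : X => Metric.closedBall (0 : LinfSpace N) (dist x x0 + 2)) := by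
    intro k x _
    have h1 := (abs_le.1 (hg k x x0)).2
    rw [hg0] at h1
    have h2 : 1 / ((k : ℝ) + 1) ≤ 1 := by
      rw [div_le_one (by positivity)]
      have : (0 : ℝ) ≤ k := by positivity
      linarith
    rw [Metric.mem_closedBall]
    linarith
  obtain ⟨f, -, φ, hφ, hlim⟩ := hK.tendsto_subseq hmem
  refine ⟨f, fun x y => ?_⟩
  rw [tendsto_pi_nhds] at hlim
  have t1 := (hlim x).dist (hlim y)
  have t2 : Filter.Tendsto (fun k => dist (g k x) (g k y)) Filter.atTop (nhds (dist x y)) := by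
    rw [tendsto_iff_dist_tendsto_zero]
    refine squeeze_zero (fun _ => dist_nonneg) (fun k => hg k x y) ?_
    simpa using (tendsto_one_div_add_atTop_nhds_zero_nat (𝕜 := ℝ)).const_mul 2
  exact tendsto_nhds_unique t1 (t2.comp hφ.tendsto_atTop)
end

section
/- Let X be a finite metric space and Y ⊆ X a subset. If Y (with the induced metric) admits an isometric embedding into l_∞^k, then X admits an isometric embedding into l_∞^{k + |X ∖ Y|}. In particular m(X) ≤ m(Y) + |X ∖ Y|, where m(Z) denotes the least dimension d such that Z embeds isometrically into l_∞^d. -/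
theorem linf_dist_le_iff {k : ℕ} (u v : LinfSpace k) {r : ℝ} (hr : 0 ≤ r) :
    dist u v ≤ r ↔ ∀ i, dist (u i) (v i) ≤ r := by
  rw [PiLp.dist_eq_iSup]
  constructor
  · intro h i
    exact (le_ciSup (f := fun i => dist (u i) (v i)) (Set.finite_range _).bddAbove i).trans h
  · intro h
    exact Real.iSup_le h hr

/-- If a subset `Y` of a finite metric space `X` (with the induced metric) embeds
isometrically into `l_∞^k`, then `X` embeds isometrically into `l_∞^{k + |X \ Y|}`. -/
theorem embedding_extend_of_subset (X : Type) [MetricSpace X] [Fintype X]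
    (Y : Set X) (k : ℕ)
    (h : ∃ f : Y → LinfSpace k, ∀ x y : Y, dist (f x) (f y) = dist x y) :
    ∃ g : X → LinfSpace (k + (Yᶜ).ncard), ∀ x y : X, dist (g x) (g y) = dist x y := by
  classical
  obtain ⟨f, hf⟩ := h
  have hext : ∀ i : Fin k, ∃ g : X → ℝ, LipschitzWith 1 g ∧ ∀ y : Y, g y = f y i := by
    intro i
    let F : X → ℝ := fun x => if hx : x ∈ Y then f ⟨x, hx⟩ i else 0
    have hF : LipschitzOnWith 1 F Y := by
      apply LipschitzOnWith.of_dist_le_mul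
      intro x hx y hy
      have h1 := (linf_dist_le_iff (f ⟨x, hx⟩) (f ⟨y, hy⟩) dist_nonneg).1 le_rfl i
      rw [hf] at h1
      simpa [F, hx, hy, Subtype.dist_eq] using h1
    obtain ⟨g, hg, hgF⟩ := hF.extend_real
    refine ⟨g, hg, fun y => ?_⟩
    rw [← hgF y.2]
    simp [F]
  choose G hG hGf using hext
  have e : Fin (Yᶜ).ncard ≃ (Yᶜ : Set X) :=
    (Fintype.equivFinOfCardEq (by rw [← Nat.card_eq_fintype_card, Nat.card_coe_set_eq])).symm
  let g : X → LinfSpace (k + (Yᶜ).ncard) := fun x =>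
    WithLp.toLp ⊤ (Fin.addCases (fun i => G i x) (fun j => dist x (e j : X)))
  have gl : ∀ x i, g x (Fin.castAdd _ i) = G i x := fun x i => by simp [g]
  have gr : ∀ x j, g x (Fin.natAdd _ j) = dist x (e j : X) := fun x j => by simp [g]
  refine ⟨g, fun x y => le_antisymm ?_ ?_⟩
  · rw [linf_dist_le_iff _ _ dist_nonneg]
    intro i
    refine Fin.addCases (fun i => ?_) (fun j => ?_) i
    · rw [gl, gl]
      simpa using (hG i).dist_le_mul x y
    · rw [gr, gr]
      exact dist_dist_dist_le_left x y _
  · have key := (linf_dist_le_iff (g x) (g y) dist_nonneg).1 le_rfl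
    by_cases hx : x ∈ Y
    · by_cases hy : y ∈ Y
      · have h2 : dist (f ⟨x, hx⟩) (f ⟨y, hy⟩) ≤ dist (g x) (g y) := by
          rw [linf_dist_le_iff _ _ dist_nonneg]
          intro i
          have := key (Fin.castAdd _ i)
          rw [gl, gl] at this
          rwa [← hGf, ← hGf]
        rw [hf] at h2
        exact h2
      · have := key (Fin.natAdd _ (e.symm ⟨y, hy⟩))
        rw [gr, gr] at this
        simpa [Real.dist_eq] using this
    · have := key (Fin.natAdd _ (e.symm ⟨x, hx⟩))
      rw [gr, gr] at this
      simpa [Real.dist_eq, dist_comm y x] using this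
end

section
/- Let X be a finite metric space, let T be a simple graph on the vertex set X which is a tree (connected and acyclic) such that any two vertices are joined by a path with at most 4 edges. Let s : X → Bool be a 2-coloring such that adjacent vertices of T receive different values, and let f : X → ℝ be a function such that f(a) − f(b) = dist(a,b) whenever a and b are adjacent in T and s(a) = true. Then f is 1-Lipschitz on X if and only if for every path a–b–c–d of three edges in T (i.e. a,b,c,d with a ≠ c, b ≠ d, and ab, bc, cd edges of T) one has dist(a,d) + dist(b,c) ≥ dist(a,b) + dist(c,d). -/
/-- Let `T` be a tree on a finite metric space `X` in which any two vertices are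
joined by a path of at most 4 edges.  Let `s` be a proper 2-coloring of `T`
(encoding an orientation with no directed path of length 2) and `f : X → ℝ` a
function with `f a - f b = dist a b` for every edge `a–b` with `s a = true`.
Then `f` is 1-Lipschitz iff for every three-edge path `a–b–c–d` in `T` one has
`dist a d + dist b c ≥ dist a b + dist c d`. -/
theorem lipschitz_iff_path_condition (X : Type) [MetricSpace X] [Fintype X]
    (T : SimpleGraph X) (hT : T.IsTree) (hdiam : ∀ a b : X, T.dist a b ≤ 4)
    (s : X → Bool) (hs : ∀ a b : X, T.Adj a b → s a ≠ s b)
    (f : X → ℝ) (hf : ∀ a b : X, T.Adj a b → s a = true → f a - f b = dist a b) :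
    (∀ x y : X, |f x - f y| ≤ dist x y) ↔
      (∀ a b c d : X, T.Adj a b → T.Adj b c → T.Adj c d → a ≠ c → b ≠ d →
        dist a b + dist c d ≤ dist a d + dist b c) := by
  have key : ∀ a b : X, T.Adj a b →
      (s a = true ∧ s b = false ∧ f a - f b = dist a b) ∨
      (s a = false ∧ s b = true ∧ f b - f a = dist a b) := by
    intro a b h
    have h1 := hs a b h
    cases ha : s a
    · have hb : s b = true := by
        cases hb : s b
        · exact absurd (ha.trans hb.symm) h1
        · rfl
      right
      exact ⟨rfl, hb, by rw [dist_comm]; exact hf b a h.symm hb⟩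
    · have hb : s b = false := by
        cases hb : s b
        · rfl
        · exact absurd (ha.trans hb.symm) h1
      left
      exact ⟨rfl, hb, hf a b h ha⟩
  constructor
  · intro hL a b c d hab hbc hcd _ _
    have h := abs_le.1 (hL a d)
    rcases key a b hab with ⟨p1, p2, p3⟩ | ⟨p1, p2, p3⟩ <;>
    rcases key b c hbc with ⟨q1, q2, q3⟩ | ⟨q1, q2, q3⟩ <;>
    rcases key c d hcd with ⟨r1, r2, r3⟩ | ⟨r1, r2, r3⟩ <;>
    first
    | (exfalso; simp_all; done)
    | linarith [h.1, h.2]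
  · intro hP x y
    obtain ⟨p, hp, hlen⟩ := hT.connected.exists_path_of_dist x y
    have h4 : p.length ≤ 4 := hlen ▸ hdiam x y
    clear hlen
    rw [abs_le]
    match p, hp, h4 with
    | .nil, _, _ => simp
    | .cons h1 .nil, _, _ =>
      have := @dist_nonneg X _ x y
      rcases key _ _ h1 with ⟨p1, p2, p3⟩ | ⟨p1, p2, p3⟩ <;> constructor <;> linarith
    | .cons (v := b) h1 (.cons h2 .nil), _, _ =>
      have t1 := dist_triangle x y b
      have t2 := dist_triangle b x y
      rw [dist_comm y b] at t1
      rw [dist_comm b x] at t2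
      rcases key _ _ h1 with ⟨p1, p2, p3⟩ | ⟨p1, p2, p3⟩ <;>
      rcases key _ _ h2 with ⟨q1, q2, q3⟩ | ⟨q1, q2, q3⟩ <;>
      first
      | (exfalso; simp_all; done)
      | (constructor <;> linarith)
    | .cons (v := b) h1 (.cons (v := c) h2 (.cons h3 .nil)), hp, _ =>
      simp [SimpleGraph.Walk.cons_isPath_iff] at hp
      have c1 := hP _ _ _ _ h1 h2 h3 (by grind) (by grind)
      have t1 := dist_triangle4 b x y c
      rw [dist_comm b x, dist_comm y c] at t1
      rcases key _ _ h1 with ⟨p1, p2, p3⟩ | ⟨p1, p2, p3⟩ <;>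
      rcases key _ _ h2 with ⟨q1, q2, q3⟩ | ⟨q1, q2, q3⟩ <;>
      rcases key _ _ h3 with ⟨r1, r2, r3⟩ | ⟨r1, r2, r3⟩ <;>
      first
      | (exfalso; simp_all; done)
      | (constructor <;> linarith)
    | .cons (v := b) h1 (.cons (v := c) h2 (.cons (v := d) h3 (.cons h4 .nil))), hp, _ =>
      simp [SimpleGraph.Walk.cons_isPath_iff] at hp
      have c1 := hP _ _ _ _ h1 h2 h3 (by grind) (by grind)
      have c2 := hP _ _ _ _ h2 h3 h4 (by grind) (by grind)
      have t1 := dist_triangle x y d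
      have t2 := dist_triangle b x y
      rw [dist_comm y d] at t1
      rw [dist_comm b x] at t2
      rcases key _ _ h1 with ⟨p1, p2, p3⟩ | ⟨p1, p2, p3⟩ <;>
      rcases key _ _ h2 with ⟨q1, q2, q3⟩ | ⟨q1, q2, q3⟩ <;>
      rcases key _ _ h3 with ⟨r1, r2, r3⟩ | ⟨r1, r2, r3⟩ <;>
      rcases key _ _ h4 with ⟨u1, u2, u3⟩ | ⟨u1, u2, u3⟩ <;>
      first
      | (exfalso; simp_all; done)
      | (constructor <;> linarith)
    | .cons _ (.cons _ (.cons _ (.cons _ (.cons _ _)))), _, h =>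
      simp only [SimpleGraph.Walk.length_cons] at h
      omega
end

section
/- Let k ≥ 1 and let d be a metric on 2k ordered points which is monochromatic of colour 321, i.e. every quadruple of indices a < b < c < d satisfies R₃ > R₂ > R₁ where R₁ = d(a,b) + d(c,d), R₂ = d(a,c) + d(b,d), R₃ = d(a,d) + d(b,c). Then this metric space admits an isometric embedding into l_∞^k. -/
/-- A metric on `Fin n`, given as an explicit distance function. -/
def IsMetric {n : ℕ} (d : Fin n → Fin n → ℝ) : Prop :=
  (∀ i, d i i = 0) ∧ (∀ i j, d i j = d j i) ∧ (∀ i j, i ≠ j → 0 < d i j) ∧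
  (∀ i j k, d i k ≤ d i j + d j k)

open Classical in
/-- coordinate `t` of the embedding -/
noncomputable def coordFn (k : ℕ) (d : Fin (2 * k) → Fin (2 * k) → ℝ) (t : Fin k)
    (x : Fin (2 * k)) : ℝ :=
  if (t.1 ≤ x.1 ∧ x.1 < k) ∨ 2 * k - 1 - t.1 < x.1 then
    d ⟨t.1, by omega⟩ ⟨2 * k - 1 - t.1, by omega⟩ - d x ⟨2 * k - 1 - t.1, by omega⟩
  else d ⟨t.1, by omega⟩ x

lemma coordFn_lip (k : ℕ) (d : Fin (2 * k) → Fin (2 * k) → ℝ) (hd : IsMetric d)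
    (mono : ∀ a b c e : Fin (2 * k), a < b → b < c → c < e →
      d a e + d b c > d a c + d b e ∧ d a c + d b e > d a b + d c e)
    (t : Fin k) (x y : Fin (2 * k)) :
    |coordFn k d t x - coordFn k d t y| ≤ d x y := by
  obtain ⟨h0, hs, -, ht⟩ := hd
  have key : ∀ p q a b : Fin (2 * k), p.1 = t.1 → q.1 = 2 * k - 1 - t.1 →
      ((t.1 ≤ a.1 ∧ a.1 < k) ∨ 2 * k - 1 - t.1 < a.1) →
      ¬ ((t.1 ≤ b.1 ∧ b.1 < k) ∨ 2 * k - 1 - t.1 < b.1) →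
      |d p q - d a q - d p b| ≤ d a b := by
    intro p q a b hp hq ha hb
    have htk := t.2
    have l1 : d p q ≤ d a q + d p b + d a b := by
      linarith [ht p b q, ht b a q, hs a b]
    have l2 : d p b + d a q ≤ d a b + d p q := by
      by_cases e1 : a = p
      · subst e1; linarith
      by_cases e2 : b = q
      · subst e2; linarith
      have e1' : a.1 ≠ p.1 := fun h => e1 (Fin.ext h)
      have e2' : b.1 ≠ q.1 := fun h => e2 (Fin.ext h)
      rcases ha with ha | ha
      · by_cases hbt : b.1 < t.1
        · have := mono b p a q (Fin.lt_def.2 (by omega)) (Fin.lt_def.2 (by omega))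
            (Fin.lt_def.2 (by omega))
          linarith [hs a b, hs b p]
        · have := mono p a b q (Fin.lt_def.2 (by omega)) (Fin.lt_def.2 (by omega))
            (Fin.lt_def.2 (by omega))
          linarith
      · by_cases hbt : b.1 < t.1
        · have := mono b p q a (Fin.lt_def.2 (by omega)) (Fin.lt_def.2 (by omega))
            (Fin.lt_def.2 (by omega))
          linarith [hs a b, hs b p, hs a q]
        · have := mono p b q a (Fin.lt_def.2 (by omega)) (Fin.lt_def.2 (by omega))
            (Fin.lt_def.2 (by omega))
          linarith [hs a b, hs a q]
    rw [abs_le]; constructor <;> linarith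
  unfold coordFn
  split_ifs with hx hy hy
  · rw [abs_le]
    constructor
    · linarith [ht x y ⟨2 * k - 1 - t.1, by omega⟩]
    · linarith [ht y x ⟨2 * k - 1 - t.1, by omega⟩, hs x y]
  · exact key _ _ x y rfl rfl hx hy
  · rw [abs_sub_comm, hs x y]
    exact key _ _ y x rfl rfl hy hx
  · rw [abs_le]
    constructor
    · linarith [ht ⟨t.1, by omega⟩ x y]
    · linarith [ht ⟨t.1, by omega⟩ y x, hs x y]

lemma coordFn_cover (k : ℕ) (d : Fin (2 * k) → Fin (2 * k) → ℝ) (hd : IsMetric d)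
    (x y : Fin (2 * k)) (hxy : x.1 < y.1) :
    ∃ t : Fin k, d x y ≤ |coordFn k d t x - coordFn k d t y| := by
  obtain ⟨h0, hs, -, -⟩ := hd
  have hx := x.2
  have hy := y.2
  by_cases c1 : y.1 < k
  · refine ⟨⟨y.1, c1⟩, ?_⟩
    unfold coordFn
    rw [if_neg (by simp only; omega), if_pos (by simp only; omega)]
    simp only [Fin.eta, sub_self, sub_zero]
    rw [hs x y]; exact le_abs_self _
  by_cases c2 : k ≤ x.1
  · refine ⟨⟨2 * k - 1 - x.1, by omega⟩, ?_⟩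
    unfold coordFn
    rw [if_neg (by simp only; omega), if_pos (by simp only; omega)]
    have e : ∀ h, (⟨2 * k - 1 - (2 * k - 1 - x.1), h⟩ : Fin (2 * k)) = x :=
      fun h => Fin.ext (by simp only; omega)
    simp only [e, sub_sub_cancel]
    rw [hs x y]; exact le_abs_self _
  by_cases c3 : y.1 ≤ 2 * k - 1 - x.1
  · refine ⟨⟨x.1, by omega⟩, ?_⟩
    unfold coordFn
    rw [if_pos (by simp only; omega), if_neg (by simp only; omega)]
    simp only [Fin.eta, sub_self, zero_sub, abs_neg]
    exact le_abs_self _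
  · refine ⟨⟨2 * k - 1 - y.1, by omega⟩, ?_⟩
    unfold coordFn
    rw [if_pos (by simp only; omega), if_neg (by simp only; omega)]
    have e : ∀ h, (⟨2 * k - 1 - (2 * k - 1 - y.1), h⟩ : Fin (2 * k)) = y :=
      fun h => Fin.ext (by simp only; omega)
    simp only [e]
    rw [abs_sub_comm, sub_sub_cancel]; exact le_abs_self _

/-- A metric on `2k` ordered points (`k ≥ 1`) which is monochromatic of colour 321,
i.e. every quadruple `a < b < c < e` satisfies `R₃ > R₂ > R₁` where
`R₁ = d a b + d c e`, `R₂ = d a c + d b e`, `R₃ = d a e + d b c`,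
embeds isometrically into `l_∞^k`. -/
theorem monochromatic_321_embeds (k : ℕ) (hk : 1 ≤ k)
    (d : Fin (2 * k) → Fin (2 * k) → ℝ) (hd : IsMetric d)
    (mono : ∀ a b c e : Fin (2 * k), a < b → b < c → c < e →
      d a e + d b c > d a c + d b e ∧ d a c + d b e > d a b + d c e) :
    ∃ f : Fin (2 * k) → LinfSpace k, ∀ x y : Fin (2 * k), dist (f x) (f y) = d x y := by
  have : Nonempty (Fin k) := ⟨⟨0, hk⟩⟩
  refine ⟨fun x => WithLp.toLp ⊤ (fun t => coordFn k d t x), fun x y => ?_⟩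
  rw [PiLp.dist_eq_iSup]
  simp only [Real.dist_eq]
  apply le_antisymm
  · exact ciSup_le fun t => coordFn_lip k d hd mono t x y
  · have h : ∃ t : Fin k, d x y ≤ |coordFn k d t x - coordFn k d t y| := by
      rcases lt_trichotomy x.1 y.1 with h | h | h
      · exact coordFn_cover k d hd x y h
      · have := Fin.ext h
        subst this
        exact ⟨⟨0, hk⟩, by rw [hd.1]; positivity⟩
      · obtain ⟨t, h⟩ := coordFn_cover k d hd y x h
        exact ⟨t, by rw [hd.2.1, abs_sub_comm]; exact h⟩
    obtain ⟨t, h⟩ := h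
    exact h.trans (le_ciSup (f := fun t => |coordFn k d t x - coordFn k d t y|)
      (Set.finite_range _).bddAbove t)
end

section
/- Let n ≥ 1 and let d be a metric on 4n+1 ordered points which is monochromatic of colour 231, i.e. every quadruple of indices a < b < c < d satisfies R₂ > R₃ > R₁, where R₁ = d(a,b) + d(c,d), R₂ = d(a,c) + d(b,d), R₃ = d(a,d) + d(b,c). Then this metric space admits an isometric embedding into l_∞^{3n}. -/
/-- partial sums along the zigzag path -/
noncomputable def zzF (D : ℕ → ℕ → ℝ) (M : ℕ) : ℕ → ℝ
  | 0 => 0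
  | (i+1) => zzF D M i + (D (i+1) (M - i) - D i (M - i))

/-- zigzag potential on `0..M` with `M = 2m` -/
noncomputable def zzG (D : ℕ → ℕ → ℝ) (m : ℕ) (p : ℕ) : ℝ :=
  if p ≤ m then zzF D (2*m) p else zzF D (2*m) (2*m - p) - D (2*m - p) p

theorem zz_up (D : ℕ → ℕ → ℝ) (m : ℕ)
    (K : ∀ a b c e, a < b → b < c → c < e → e ≤ 2*m → D a e + D b c ≤ D a c + D b e)
    (j : ℕ) (t : ℕ) (h : j + t ≤ m) :
    zzF D (2*m) (j+t) - zzF D (2*m) j ≤ D (j+t) (2*m-j) - D j (2*m-j) := by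
  induction t with
  | zero => simp
  | succ t ih =>
    have ih := ih (by omega)
    have e : zzF D (2*m) (j+(t+1)) = zzF D (2*m) (j+t)
      + (D (j+t+1) (2*m-(j+t)) - D (j+t) (2*m-(j+t))) := rfl
    rw [e, ← add_assoc]
    rcases Nat.eq_zero_or_pos t with h0 | h0
    · subst h0; simp
    · have := K (j+t) (j+t+1) (2*m-(j+t)) (2*m-j) (by omega) (by omega) (by omega) (by omega)
      linarith

theorem zz_down (D : ℕ → ℕ → ℝ) (m : ℕ)
    (K : ∀ a b c e, a < b → b < c → c < e → e ≤ 2*m → D a e + D b c ≤ D a c + D b e)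
    (j : ℕ) (hj : j < m) (t : ℕ) (a : ℕ) (h : a + t = j) :
    zzF D (2*m) a - zzF D (2*m) j ≤ D a (2*m-j) - D j (2*m-j) := by
  induction t generalizing a with
  | zero => simp at h; subst h; simp
  | succ t ih =>
    have ih := ih (a+1) (by omega)
    have e : zzF D (2*m) (a+1) = zzF D (2*m) a
      + (D (a+1) (2*m-a) - D a (2*m-a)) := rfl
    rw [e] at ih
    have := K a (a+1) (2*m-j) (2*m-a) (by omega) (by omega) (by omega) (by omega)
    linarith

theorem zz_lip (D : ℕ → ℕ → ℝ) (m : ℕ) (hm : 1 ≤ m)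
    (hsymm : ∀ i j, D i j = D j i) (htri : ∀ i j k, D i k ≤ D i j + D j k)
    (K : ∀ a b c e, a < b → b < c → c < e → e ≤ 2*m → D a e + D b c ≤ D a c + D b e)
    (p q : ℕ) (hp : p ≤ 2*m) (hq : q ≤ 2*m) :
    zzG D m p - zzG D m q ≤ D p q := by
  have key : ∀ a b, a ≤ m → m < b → b ≤ 2*m → zzG D m a - zzG D m b ≤ D a b := by
    intro a b ha hb hb2
    unfold zzG
    rw [if_pos ha, if_neg (by omega)]
    obtain ⟨j, rfl⟩ : ∃ j, b = 2*m - j := ⟨2*m-b, by omega⟩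
    have hj : j < m := by omega
    have e : 2*m - (2*m - j) = j := by omega
    rw [e]
    rcases le_total j a with h | h
    · obtain ⟨t, rfl⟩ := Nat.exists_eq_add_of_le h
      have := zz_up D m K j t ha
      linarith
    · obtain ⟨t, ht⟩ := Nat.exists_eq_add_of_le h
      have := zz_down D m K j hj t a ht.symm
      linarith
  have tB : ∀ b, m < b → b ≤ 2*m → ∃ a, a ≤ m ∧ zzG D m a - zzG D m b = D a b := by
    intro b hb hb2
    refine ⟨2*m-b, by omega, ?_⟩
    unfold zzG
    rw [if_pos (by omega), if_neg (by omega)]; ring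
  have tA : ∀ a, a ≤ m → ∃ b, m < b ∧ b ≤ 2*m ∧ zzG D m a - zzG D m b = D a b := by
    intro a ha
    rcases Nat.lt_or_ge a m with h | h
    · refine ⟨2*m-a, by omega, by omega, ?_⟩
      unfold zzG
      have e : 2*m - (2*m - a) = a := by omega
      rw [if_pos (by omega), if_neg (by omega), e]; ring
    · obtain ⟨j, rfl⟩ : ∃ j, a = j+1 := ⟨a-1, by omega⟩
      refine ⟨2*m-j, by omega, by omega, ?_⟩
      unfold zzG
      have e : 2*m - (2*m - j) = j := by omega
      rw [if_pos (by omega), if_neg (by omega), e]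
      simp only [zzF]; ring
  rcases Nat.lt_or_ge m p with h1 | h1 <;> rcases Nat.lt_or_ge m q with h2 | h2
  · obtain ⟨a, ha, e⟩ := tB p h1 hp
    have := key a q ha h2 hq
    have := htri a p q
    linarith
  · obtain ⟨b, hb, hb2, e⟩ := tA q h2
    obtain ⟨a, ha, e'⟩ := tB p h1 hp
    have := key a b ha hb hb2
    have := htri a p b
    have := htri p q b
    linarith
  · exact key p q h1 h2 hq
  · obtain ⟨b, hb, hb2, e⟩ := tA q h2
    have := key p b h1 hb hb2
    have := htri p q b
    linarith

theorem zz_tight (D : ℕ → ℕ → ℝ) (m : ℕ) (p q : ℕ) (hpq : p < q) (hq : q ≤ 2*m)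
    (h : p + q = 2*m ∨ p + q = 2*m+1) :
    zzG D m p - zzG D m q = D p q := by
  unfold zzG
  rw [if_pos (by omega), if_neg (by omega)]
  rcases h with h | h
  · have e : 2*m - q = p := by omega
    rw [e]; ring
  · obtain ⟨j, rfl⟩ : ∃ j, p = j+1 := ⟨p-1, by omega⟩
    have e : 2*m - q = j := by omega
    have e' : 2*m - j = q := by omega
    rw [e]; simp only [zzF]; rw [e']; ring

theorem rot_kal (N : ℕ) (d : Fin N → Fin N → ℝ) (hs : ∀ i j, d i j = d j i)
    (mono : ∀ a b c e : Fin N, a < b → b < c → c < e →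
      d a c + d b e > d a e + d b c ∧ d a e + d b c > d a b + d c e)
    (a b c e : Fin N) (h : (a < b ∧ b < c ∧ c < e) ∨ (b < c ∧ c < e ∧ e < a) ∨
      (c < e ∧ e < a ∧ a < b) ∨ (e < a ∧ a < b ∧ b < c)) :
    d a e + d b c ≤ d a c + d b e := by
  rcases h with ⟨h1, h2, h3⟩ | ⟨h1, h2, h3⟩ | ⟨h1, h2, h3⟩ | ⟨h1, h2, h3⟩ <;>
  have := mono _ _ _ _ h1 h2 h3 <;>
  have := hs a b <;> have := hs a c <;> have := hs a e <;> have := hs b c <;>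
  have := hs b e <;> have := hs c e <;> linarith

theorem monochromatic_231_embeds (n : ℕ) (hn : 1 ≤ n)
    (d : Fin (4 * n + 1) → Fin (4 * n + 1) → ℝ) (hd : IsMetric d)
    (mono : ∀ a b c e : Fin (4 * n + 1), a < b → b < c → c < e →
      d a c + d b e > d a e + d b c ∧ d a e + d b c > d a b + d c e) :
    ∃ f : Fin (4 * n + 1) → LinfSpace (3 * n),
      ∀ x y : Fin (4 * n + 1), dist (f x) (f y) = d x y := by
  obtain ⟨h0, hs, hpos, htri⟩ := hd
  let N := 4*n+1
  let r : ℕ → ℕ → Fin (4*n+1) := fun k i => ⟨(i+k) % (4*n+1), Nat.mod_lt _ (by omega)⟩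
  let D : ℕ → ℕ → ℕ → ℝ := fun k i j => d (r k i) (r k j)
  have rval : ∀ k i, k < 4*n+1 → i < 4*n+1 →
      (i + k < 4*n+1 ∧ (r k i).val = i+k) ∨
      (4*n+1 ≤ i + k ∧ (r k i).val + (4*n+1) = i+k) := by
    intro k i hk hi
    rcases Nat.lt_or_ge (i+k) (4*n+1) with h | h
    · exact Or.inl ⟨h, Nat.mod_eq_of_lt h⟩
    · refine Or.inr ⟨h, ?_⟩
      change (i+k) % (4*n+1) + (4*n+1) = i+k
      rw [Nat.mod_eq_sub_mod h, Nat.mod_eq_of_lt (by omega)]; omega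
  have K : ∀ k, k < 4*n+1 → ∀ a b c e, a < b → b < c → c < e → e ≤ 2*(2*n) →
      D k a e + D k b c ≤ D k a c + D k b e := by
    intro k hk a b c e h1 h2 h3 h4
    apply rot_kal _ d hs mono
    have := rval k a hk (by omega)
    have := rval k b hk (by omega)
    have := rval k c hk (by omega)
    have := rval k e hk (by omega)
    simp only [Fin.lt_def]
    omega
  -- inverse rotation
  have inv : ∀ k, k < 4*n+1 → ∀ x : Fin (4*n+1), ∃ p, p ≤ 2*(2*n) ∧ r k p = x := by
    intro k hk x
    rcases Nat.lt_or_ge x.val k with h | h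
    · refine ⟨x.val + (4*n+1) - k, by omega, ?_⟩
      have := rval k (x.val + (4*n+1) - k) hk (by omega)
      apply Fin.ext; omega
    · refine ⟨x.val - k, by omega, ?_⟩
      have := rval k (x.val - k) hk (by omega)
      apply Fin.ext; omega
  choose P hP1 hP2 using inv
  have kl : ∀ k : Fin (3*n), k.val < 4*n+1 := fun k => by omega
  let g : Fin (3*n) → Fin (4*n+1) → ℝ := fun k x => zzG (D k.val) (2*n) (P k.val (kl k) x)
  have lip : ∀ k x y, g k x - g k y ≤ d x y := by
    intro k x y
    have := zz_lip (D k.val) (2*n) (by omega) (fun i j => hs _ _) (fun i j l => htri _ _ _)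
      (K k.val (kl k)) (P k.val (kl k) x) (P k.val (kl k) y) (hP1 _ _ _) (hP1 _ _ _)
    have e : D k.val (P k.val (kl k) x) (P k.val (kl k) y) = d x y := by
      simp only [D, hP2]
    rw [e] at this
    exact this
  have cover : ∀ x y : Fin (4*n+1), x ≠ y → ∃ k, d x y ≤ |g k x - g k y| := by
    intro x y hxy
    have hv : x.val ≠ y.val := fun h => hxy (Fin.ext h)
    obtain ⟨k, hk, hc⟩ : ∃ k, k ≤ 2*n ∧ (2*k = x.val + y.val ∨ 2*k = x.val + y.val + 1 ∨
        2*k + (4*n+1) = x.val + y.val ∨ 2*k + (4*n+1) = x.val + y.val + 1) := by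
      rcases Nat.lt_or_ge (x.val + y.val) (4*n+1) with h | h
      · exact ⟨(x.val+y.val+1)/2, by omega, by omega⟩
      · exact ⟨(x.val+y.val+1-(4*n+1))/2, by omega, by omega⟩
    refine ⟨⟨k, by omega⟩, ?_⟩
    have hk' : k < 4*n+1 := by omega
    have ep : ∀ x, D k (P k hk' x) = fun j => d x (r k j) := by
      intro x; simp only [D, hP2]
    have hpx := hP1 k hk' x
    have hpy := hP1 k hk' y
    have ex := rval k _ hk' (Nat.lt_succ_of_le (by omega : P k hk' x ≤ 4*n))
    have ey := rval k _ hk' (Nat.lt_succ_of_le (by omega : P k hk' y ≤ 4*n))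
    rw [hP2] at ex ey
    have hsum : P k hk' x + P k hk' y = 2*(2*n) ∨ P k hk' x + P k hk' y = 2*(2*n)+1 := by
      omega
    change d x y ≤ |zzG (D k) (2*n) (P k hk' x) - zzG (D k) (2*n) (P k hk' y)|
    rcases lt_trichotomy (P k hk' x) (P k hk' y) with h | h | h
    · rw [zz_tight (D k) (2*n) _ _ h hpy hsum]
      simp only [D, hP2]; exact le_abs_self _
    · exfalso; omega
    · rw [abs_sub_comm, zz_tight (D k) (2*n) _ _ h hpx (by omega)]
      simp only [D, hP2]; rw [hs x y]; exact le_abs_self _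
  have : Nonempty (Fin (3*n)) := ⟨⟨0, by omega⟩⟩
  refine ⟨fun x => WithLp.toLp ⊤ (fun k => g k x), fun x y => ?_⟩
  rw [PiLp.dist_eq_iSup]
  have ub : ∀ k, dist (g k x) (g k y) ≤ d x y := by
    intro k
    rw [Real.dist_eq, abs_le]
    have := lip k x y
    have := lip k y x
    have := hs x y
    constructor <;> linarith
  apply le_antisymm
  · exact ciSup_le ub
  · by_cases hxy : x = y
    · subst hxy
      rw [h0]
      exact Real.iSup_nonneg (fun k => dist_nonneg)
    · obtain ⟨k, hk⟩ := cover x y hxy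
      exact le_trans hk (le_ciSup (f := fun k => dist (g k x) (g k y))
        (Set.finite_range _).bddAbove k)
end
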